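/- If A is strongly π-regular (for every f ∈ A there exist an integer n ≥ 1 and g, h ∈ A with f^n = g ∘ f^{n+1} and f^n = f^{n+1} ∘ h), then R is strongly π-regular: for every a ∈ R there exist an integer n ≥ 1 and b, c ∈ R with a^n = b * a^{n+1} and a^n = a^{n+1} * c. -/

import Mathlib

/-- A (possibly nonunital) ring has local units if every finite set of elements
admits an idempotent acting as a two-sided unit on them. -/
def HasLocalUnits (R : Type*) [NonUnitalRing R] : Prop :=
  ∀ s : Finset R, ∃ u : R, u * u = u ∧ ∀ a ∈ s, u * a = a ∧ a * u = a

/-- The endomorphism ring `A = End(R_R)` of `R` as a right `R`-module: the subring of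
`AddMonoid.End R` consisting of additive endomorphisms `f` with `f (x * r) = f x * r`. -/
def REnd (R : Type*) [NonUnitalRing R] : Subring (AddMonoid.End R) where
  carrier := {f | ∀ x r : R, f (x * r) = f x * r}
  zero_mem' := fun x r => by simp
  one_mem' := fun x r => rfl
  add_mem' := fun {f g} hf hg x r => by
    show f (x * r) + g (x * r) = (f x + g x) * r
    rw [hf, hg, add_mul]
  neg_mem' := fun {f} hf x r => by
    show -(f (x * r)) = -(f x) * r
    rw [hf, neg_mul]
  mul_mem' := fun {f g} hf hg x r => by
    show f (g (x * r)) = f (g x) * r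
    rw [hg, hf]

/-- `lam x = λ_x` is left multiplication by `x`, as an element of `REnd R`. -/
def lam {R : Type*} [NonUnitalRing R] (x : R) : REnd R :=
  ⟨AddMonoidHom.mulLeft x, fun y r => (mul_assoc x y r).symm⟩

/-- `npow₁ a n = a^(n+1)`, the `(n+1)`-fold product, well-defined in a nonunital ring. -/
def npow₁ {R : Type*} [NonUnitalRing R] (a : R) : ℕ → R
  | 0 => a
  | n + 1 => npow₁ a n * a

theorem lam_pow_apply {R : Type*} [NonUnitalRing R] (a : R) (n : ℕ) (x : R) :
    ((lam a) ^ (n + 1)).1 x = npow₁ a n * x := by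
  induction n generalizing x with
  | zero => rw [zero_add, pow_one]; rfl
  | succ n ih =>
    rw [pow_succ]
    show ((lam a) ^ (n + 1)).1 (a * x) = npow₁ a n * a * x
    rw [ih, mul_assoc]

theorem npow₁_unit {R : Type*} [NonUnitalRing R] (a u : R) (h1 : u * a = a) (h2 : a * u = a)
    (n : ℕ) : u * npow₁ a n = npow₁ a n ∧ npow₁ a n * u = npow₁ a n := by
  induction n with
  | zero => exact ⟨h1, h2⟩
  | succ n ih =>
    show u * (npow₁ a n * a) = npow₁ a n * a ∧ npow₁ a n * a * u = npow₁ a n * a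
    rw [← mul_assoc, ih.1, mul_assoc, h2]
    exact ⟨rfl, rfl⟩

/-- if `A` is strongly π-regular then `R` is strongly π-regular
(here `npow₁ a (n-1) = a^n` and `npow₁ a n = a^(n+1)` for `n ≥ 1`). -/
theorem stronglyPiRegular_of_end {R : Type*} [NonUnitalRing R] (hR : HasLocalUnits R)
    (hA : ∀ f : REnd R, ∃ n : ℕ, 1 ≤ n ∧ ∃ g h : REnd R,
      f ^ n = g * f ^ (n + 1) ∧ f ^ n = f ^ (n + 1) * h) :
    ∀ a : R, ∃ n : ℕ, 1 ≤ n ∧ ∃ b c : R,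
      npow₁ a (n - 1) = b * npow₁ a n ∧ npow₁ a (n - 1) = npow₁ a n * c := by
  intro a
  obtain ⟨u, -, hu⟩ := hR {a}
  obtain ⟨h1, h2⟩ := hu a (Finset.mem_singleton_self a)
  obtain ⟨n, hn, g, h, hg, hh⟩ := hA (lam a)
  obtain ⟨m, rfl⟩ : ∃ m, n = m + 1 := ⟨n - 1, by omega⟩
  refine ⟨m + 1, hn, g.1 u, h.1 u, ?_, ?_⟩
  · have e : ((lam a) ^ (m + 1)).1 u = g.1 (((lam a) ^ (m + 1 + 1)).1 u) :=
      congrArg (fun f : REnd R => f.1 u) hg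
    rw [lam_pow_apply, lam_pow_apply, (npow₁_unit a u h1 h2 _).2,
      (npow₁_unit a u h1 h2 _).2] at e
    rw [← g.2 u, (npow₁_unit a u h1 h2 _).1]
    exact e
  · have e : ((lam a) ^ (m + 1)).1 u = ((lam a) ^ (m + 1 + 1)).1 (h.1 u) :=
      congrArg (fun f : REnd R => f.1 u) hh
    rw [lam_pow_apply, lam_pow_apply, (npow₁_unit a u h1 h2 _).2] at e
    exact e
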